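/- Let n = 2^m, 0 ≤ i ≤ n−1, u_{2i−1} ∈ F_2^{2i} and u_{2i} ∈ F_2. Then the weight enumerating functions of polar cosets satisfy A_{2n}^{(2i)}(u_{2i−1}, u_{2i})(X) = ∑_{u_{2i+1} ∈ F_2} A_n^{(i)}(u_{2i−1,even} ⊕ u_{2i−1,odd}, u_{2i} ⊕ u_{2i+1})(X) · A_n^{(i)}(u_{2i−1,odd}, u_{2i+1})(X). -/

import Mathlib

open Matrix

/-- The 2×2 polar kernel over F₂. -/
def K2 : Matrix (Fin 2) (Fin 2) (ZMod 2) := !![1, 0; 1, 1]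

/-- The `m`-fold Kronecker power of `K2`, rows and columns indexed by
binary expansions (bit `k` of the index corresponds to the `k`-th factor). -/
def kronPow (m : ℕ) : Matrix (Fin (2 ^ m)) (Fin (2 ^ m)) (ZMod 2) :=
  Matrix.of fun i j => ∏ k ∈ Finset.range m,
    K2 ⟨i.val / 2 ^ k % 2, Nat.mod_lt _ (by norm_num)⟩
       ⟨j.val / 2 ^ k % 2, Nat.mod_lt _ (by norm_num)⟩

/-- Reversal of the `m`-bit binary expansion of `i`. -/
def bitrev (m i : ℕ) : ℕ := ∑ k ∈ Finset.range m, (i / 2 ^ k % 2) * 2 ^ (m - 1 - k)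

/-- The `2^m × 2^m` bit-reversal permutation matrix. -/
def Bmat (m : ℕ) : Matrix (Fin (2 ^ m)) (Fin (2 ^ m)) (ZMod 2) :=
  Matrix.of fun i j => if (j : ℕ) = bitrev m i.val then 1 else 0

/-- The polar transformation matrix `G_n = B_n K_2^{⊗ m}`, `n = 2^m`. -/
def Gmat (m : ℕ) : Matrix (Fin (2 ^ m)) (Fin (2 ^ m)) (ZMod 2) := Bmat m * kronPow m

/-- Assembling the vector `(u_{i-1}, u_i, u')` out of a prefix `p` of length `i`,
a bit `b`, and a suffix `s` of length `n - 1 - i`. -/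
def assemble {n : ℕ} (i : ℕ) (p : Fin i → ZMod 2) (b : ZMod 2)
    (s : Fin (n - 1 - i) → ZMod 2) : Fin n → ZMod 2 :=
  fun j =>
    if h : (j : ℕ) < i then p ⟨j, h⟩
    else if h2 : (j : ℕ) = i then b
    else s ⟨(j : ℕ) - i - 1, by have h3 := j.isLt; omega⟩

/-- The polar coset `C_n^{(i)}(u_{i-1}, u_i)`, `n = 2^m`. -/
def polarCoset (m i : ℕ) (p : Fin i → ZMod 2) (b : ZMod 2) :
    Set (Fin (2 ^ m) → ZMod 2) :=
  { c | ∃ s : Fin (2 ^ m - 1 - i) → ZMod 2, c = (assemble i p b s) ᵥ* Gmat m }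

/-- Even-index subvector. -/
def evPart {i : ℕ} (p : Fin (2 * i) → ZMod 2) : Fin i → ZMod 2 :=
  fun k => p ⟨2 * k.val, by have := k.isLt; omega⟩

/-- Odd-index subvector. -/
def odPart {i : ℕ} (p : Fin (2 * i) → ZMod 2) : Fin i → ZMod 2 :=
  fun k => p ⟨2 * k.val + 1, by have := k.isLt; omega⟩

/-- Concatenation of two length-`2^m` vectors into a length-`2^(m+1)` vector. -/
def concatPow {m : ℕ} (a b : Fin (2 ^ m) → ZMod 2) : Fin (2 ^ (m + 1)) → ZMod 2 :=
  fun j =>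
    if h : (j : ℕ) < 2 ^ m then a ⟨j, h⟩
    else b ⟨(j : ℕ) - 2 ^ m, by
      have h1 := j.isLt
      have h2 : (2 : ℕ) ^ (m + 1) = 2 ^ m * 2 := pow_succ 2 m
      have h3 : 1 ≤ (2 : ℕ) ^ m := Nat.one_le_two_pow
      omega⟩

/-- The weight enumerating function `A_n^{(i)}(u_{i-1}, u_i)(X)` of a polar coset. -/
noncomputable def cosetWEF (m i : ℕ) (p : Fin i → ZMod 2) (b : ZMod 2) : Polynomial ℕ :=
  ∑ c ∈ (polarCoset m i p b).toFinite.toFinset, Polynomial.X ^ hammingNorm c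

theorem bitrev_succ (m i : ℕ) : bitrev (m + 1) i = bitrev m (i / 2) + 2 ^ m * (i % 2) := by
  unfold bitrev
  rw [Finset.sum_range_succ']
  congr 1
  · refine Finset.sum_congr rfl fun k _ => ?_
    rw [Nat.div_div_eq_div_mul, pow_succ', show m + 1 - 1 - (k + 1) = m - 1 - k by omega]
  · simp [mul_comm]

theorem bitrev_lt (m i : ℕ) : bitrev m i < 2 ^ m := by
  induction m generalizing i with
  | zero => simp [bitrev]
  | succ m ih =>
    have h1 := ih (i / 2)
    rw [bitrev_succ, pow_succ]
    rcases Nat.mod_two_eq_zero_or_one i with h | h <;> rw [h] <;> omega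

theorem Gmat_apply (m : ℕ) (i j : Fin (2 ^ m)) :
    Gmat m i j = kronPow m ⟨bitrev m i, bitrev_lt m i⟩ j := by
  rw [Gmat, Matrix.mul_apply, Finset.sum_eq_single ⟨bitrev m i, bitrev_lt m i⟩]
  · simp [Bmat]
  · intro k _ hk
    have : (k : ℕ) ≠ bitrev m i := fun h => hk (Fin.ext h)
    simp [Bmat, this]
  · simp

theorem add_two_pow_mul_div_mod_two {k m : ℕ} (hk : k < m) (x e : ℕ) :
    (x + 2 ^ m * e) / 2 ^ k % 2 = x / 2 ^ k % 2 := by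
  obtain ⟨d, rfl⟩ := Nat.exists_eq_add_of_lt hk
  rw [show x + 2 ^ (k + d + 1) * e = x + 2 ^ k * (2 * (2 ^ d * e)) by ring,
    Nat.add_mul_div_left _ _ (by positivity), Nat.add_mul_mod_self_left]

/-- Splitting an index below `2 ^ (m + 1)` into its upper bits and its lowest bit. -/
def lowBitEquiv (m : ℕ) : Fin (2 ^ m) × Fin 2 ≃ Fin (2 ^ (m + 1)) :=
  finProdFinEquiv.trans (finCongr (pow_succ 2 m).symm)

/-- Splitting an index below `2 ^ (m + 1)` into its highest bit and its lower bits. -/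
def highBitEquiv (m : ℕ) : Fin 2 × Fin (2 ^ m) ≃ Fin (2 ^ (m + 1)) :=
  finProdFinEquiv.trans (finCongr (pow_succ' 2 m).symm)

theorem lowBitEquiv_val (m : ℕ) (a : Fin (2 ^ m)) (e : Fin 2) :
    (lowBitEquiv m (a, e) : ℕ) = e + 2 * a := rfl

theorem highBitEquiv_val (m : ℕ) (f : Fin 2) (j : Fin (2 ^ m)) :
    (highBitEquiv m (f, j) : ℕ) = j + 2 ^ m * f := rfl

theorem kronPow_succ (m : ℕ) (i j : Fin (2 ^ (m + 1))) (e f : Fin 2) (a c : Fin (2 ^ m))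
    (hi : (i : ℕ) = a + 2 ^ m * e) (hj : (j : ℕ) = c + 2 ^ m * f) :
    kronPow (m + 1) i j = K2 e f * kronPow m a c := by
  have top (x : Fin (2 ^ m)) (g : Fin 2) : (x + 2 ^ m * g : ℕ) / 2 ^ m % 2 = g := by
    rw [Nat.add_mul_div_left _ _ (by positivity), Nat.div_eq_of_lt x.isLt]
    omega
  simp only [kronPow, Matrix.of_apply, Finset.prod_range_succ, hi, hj, top]
  rw [mul_comm]
  congr 1
  refine Finset.prod_congr rfl fun k hk => ?_
  simp only [add_two_pow_mul_div_mod_two (Finset.mem_range.1 hk)]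

theorem Gmat_succ (m : ℕ) (a j : Fin (2 ^ m)) (e f : Fin 2) :
    Gmat (m + 1) (lowBitEquiv m (a, e)) (highBitEquiv m (f, j)) = K2 e f * Gmat m a j := by
  rw [Gmat_apply, Gmat_apply]
  refine kronPow_succ m _ _ e f _ _ ?_ (highBitEquiv_val m f j)
  simp only [bitrev_succ, lowBitEquiv_val]
  rw [show ((e : ℕ) + 2 * a) / 2 = a by omega, show ((e : ℕ) + 2 * a) % 2 = e by omega]

/-- The pairs `(x, y) = (u_even + u_odd, u_odd)` correspond to the vectors `u`. -/
def polarSplit (m : ℕ) :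
    (Fin (2 ^ (m + 1)) → ZMod 2) ≃ (Fin (2 ^ m) → ZMod 2) × (Fin (2 ^ m) → ZMod 2) where
  toFun u := (fun a => u (lowBitEquiv m (a, 0)) + u (lowBitEquiv m (a, 1)),
    fun a => u (lowBitEquiv m (a, 1)))
  invFun v := fun j =>
    let q := (lowBitEquiv m).symm j
    ![v.1 q.1 + v.2 q.1, v.2 q.1] q.2
  left_inv u := by
    funext j
    obtain ⟨⟨a, e⟩, rfl⟩ := (lowBitEquiv m).surjective j
    fin_cases e <;> simp [add_assoc, CharTwo.add_self_eq_zero]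
  right_inv v := by
    ext a <;> simp [add_assoc, CharTwo.add_self_eq_zero]

theorem vecMul_Gmat_succ (m : ℕ) (u : Fin (2 ^ (m + 1)) → ZMod 2) (f : Fin 2) (j : Fin (2 ^ m)) :
    (u ᵥ* Gmat (m + 1)) (highBitEquiv m (f, j)) =
      ![((polarSplit m u).1 ᵥ* Gmat m) j, ((polarSplit m u).2 ᵥ* Gmat m) j] f := by
  simp only [Matrix.vecMul, dotProduct]
  rw [← (lowBitEquiv m).sum_comp, Fintype.sum_prod_type]
  simp only [Gmat_succ, Fin.sum_univ_two]
  fin_cases f <;> simp [K2, polarSplit, add_mul]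

theorem vecMul_Gmat_injective (m : ℕ) : Function.Injective fun u => u ᵥ* Gmat m := by
  induction m with
  | zero =>
    intro u v h
    have h1 : Gmat 0 = 1 := by
      have : Subsingleton (Fin (2 ^ 0)) := inferInstanceAs (Subsingleton (Fin 1))
      ext i j
      rw [Subsingleton.elim i j, Gmat_apply]
      simp [kronPow]
    simpa [h1] using h
  | succ m ih =>
    intro u v h
    have key (f : Fin 2) (j : Fin (2 ^ m)) := congrFun h (highBitEquiv m (f, j))
    simp only [vecMul_Gmat_succ] at key
    refine (polarSplit m).injective (Prod.ext (ih (funext fun j => ?_)) (ih (funext fun j => ?_)))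
    · simpa using key 0 j
    · simpa using key 1 j

theorem hammingNorm_vecMul_Gmat_succ (m : ℕ) (u : Fin (2 ^ (m + 1)) → ZMod 2) :
    hammingNorm (u ᵥ* Gmat (m + 1)) =
      hammingNorm ((polarSplit m u).1 ᵥ* Gmat m) + hammingNorm ((polarSplit m u).2 ᵥ* Gmat m) := by
  simp only [hammingNorm, Finset.card_filter]
  rw [← (highBitEquiv m).sum_comp, Fintype.sum_prod_type]
  simp only [vecMul_Gmat_succ, Fin.sum_univ_two]
  rfl

/-- The vectors of length `n` that extend the prefix `(p, b)`. -/
def StartsWith {n : ℕ} (i : ℕ) (p : Fin i → ZMod 2) (b : ZMod 2) (u : Fin n → ZMod 2) : Prop :=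
  ∀ j : Fin n, (∀ h : (j : ℕ) < i, u j = p ⟨j, h⟩) ∧ ((j : ℕ) = i → u j = b)

theorem exists_eq_assemble_iff {n i : ℕ} (p : Fin i → ZMod 2) (b : ZMod 2) (u : Fin n → ZMod 2) :
    (∃ s, u = assemble i p b s) ↔ StartsWith i p b u := by
  constructor
  · rintro ⟨s, rfl⟩ j
    refine ⟨fun h => ?_, fun h => ?_⟩
    · simp [assemble, h]
    · simp [assemble, h]
  · intro hu
    refine ⟨fun k => u ⟨k + i + 1, by omega⟩, funext fun j => ?_⟩
    unfold assemble
    split_ifs with h h2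
    · exact (hu j).1 h
    · exact (hu j).2 h2
    · exact congrArg u (Fin.ext (by simp only; omega))

open Classical in
theorem cosetWEF_eq_sum (m i : ℕ) (p : Fin i → ZMod 2) (b : ZMod 2) :
    cosetWEF m i p b = ∑ u : Fin (2 ^ m) → ZMod 2,
      if StartsWith i p b u then Polynomial.X ^ hammingNorm (u ᵥ* Gmat m) else 0 := by
  have h : (polarCoset m i p b).toFinite.toFinset =
      (Finset.univ.filter (StartsWith i p b)).image fun u => u ᵥ* Gmat m := by
    ext c
    simp only [Set.Finite.mem_toFinset, polarCoset, Set.mem_ofPred_eq, Finset.mem_image,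
      Finset.mem_filter, Finset.mem_univ, true_and, ← exists_eq_assemble_iff]
    constructor
    · rintro ⟨s, rfl⟩
      exact ⟨_, ⟨s, rfl⟩, rfl⟩
    · rintro ⟨_, ⟨s, rfl⟩, rfl⟩
      exact ⟨s, rfl⟩
  rw [cosetWEF, h, Finset.sum_image (vecMul_Gmat_injective m).injOn, Finset.sum_filter]

theorem startsWith_two_mul_iff (m i : ℕ) (p : Fin (2 * i) → ZMod 2) (b : ZMod 2)
    (u : Fin (2 ^ (m + 1)) → ZMod 2) :
    StartsWith (2 * i) p b u ↔ ∀ a : Fin (2 ^ m),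
      (∀ h : (a : ℕ) < i, u (lowBitEquiv m (a, 0)) = evPart p ⟨a, h⟩ ∧
        u (lowBitEquiv m (a, 1)) = odPart p ⟨a, h⟩) ∧
      ((a : ℕ) = i → u (lowBitEquiv m (a, 0)) = b) := by
  have val_zero (a : Fin (2 ^ m)) : (lowBitEquiv m (a, 0) : ℕ) = 2 * a := by
    rw [lowBitEquiv_val, Fin.val_zero, zero_add]
  have val_one (a : Fin (2 ^ m)) : (lowBitEquiv m (a, 1) : ℕ) = 2 * a + 1 := by
    rw [lowBitEquiv_val, Fin.val_one, add_comm]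
  constructor
  · intro h a
    refine ⟨fun ha => ⟨?_, ?_⟩, fun ha => ?_⟩
    · exact ((h _).1 (by rw [val_zero]; omega)).trans (congrArg p (Fin.ext (val_zero a)))
    · exact ((h _).1 (by rw [val_one]; omega)).trans (congrArg p (Fin.ext (val_one a)))
    · exact (h _).2 (by rw [val_zero, ha])
  · intro h k
    obtain ⟨⟨a, e⟩, rfl⟩ := (lowBitEquiv m).surjective k
    obtain rfl | rfl : e = 0 ∨ e = 1 := by omega
    · refine ⟨fun hk => ?_, fun hk => (h a).2 (by rw [val_zero] at hk; omega)⟩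
      exact ((h a).1 (by rw [val_zero] at hk; omega)).1.trans
        (congrArg p (Fin.ext (val_zero a).symm))
    · refine ⟨fun hk => ?_, fun hk => absurd hk (by rw [val_one]; omega)⟩
      exact ((h a).1 (by rw [val_one] at hk; omega)).2.trans
        (congrArg p (Fin.ext (val_one a).symm))

theorem startsWith_polarSplit_iff (m i : ℕ) (hi : i < 2 ^ m) (p : Fin (2 * i) → ZMod 2)
    (b : ZMod 2) (u : Fin (2 ^ (m + 1)) → ZMod 2) :
    StartsWith (2 * i) p b u ↔
      StartsWith i (evPart p + odPart p) (b + (polarSplit m u).2 ⟨i, hi⟩) (polarSplit m u).1 ∧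
        StartsWith i (odPart p) ((polarSplit m u).2 ⟨i, hi⟩) (polarSplit m u).2 := by
  rw [startsWith_two_mul_iff, StartsWith, StartsWith, ← forall_and]
  refine forall_congr' fun a => ?_
  simp only [polarSplit, Equiv.coe_fn_mk, Pi.add_apply]
  constructor
  · rintro ⟨h, hb⟩
    refine ⟨⟨fun ha => ?_, fun ha => ?_⟩, fun ha => (h ha).2, fun ha => ?_⟩
    · rw [(h ha).1, (h ha).2]
    · obtain rfl : a = ⟨i, hi⟩ := Fin.ext ha
      rw [hb ha]
    · obtain rfl : a = ⟨i, hi⟩ := Fin.ext ha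
      rfl
  · rintro ⟨⟨hx, hxb⟩, hy, -⟩
    refine ⟨fun ha => ⟨?_, hy ha⟩, fun ha => ?_⟩
    · have h := hx ha
      rwa [hy ha, add_left_inj] at h
    · obtain rfl : a = ⟨i, hi⟩ := Fin.ext ha
      exact add_right_cancel (hxb ha)

/-- The recursion for weight enumerating functions at even indices:
`A_{2n}^{(2i)}(u_{2i-1}, u_{2i})(X) = ∑_{u_{2i+1} ∈ F₂}
  A_n^{(i)}(u_{2i-1,even} ⊕ u_{2i-1,odd}, u_{2i} ⊕ u_{2i+1})(X) ·
  A_n^{(i)}(u_{2i-1,odd}, u_{2i+1})(X)`. -/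
theorem cosetWEF_even_rec (m i : ℕ) (hi : i < 2 ^ m)
    (p : Fin (2 * i) → ZMod 2) (b : ZMod 2) :
    cosetWEF (m + 1) (2 * i) p b =
      ∑ b' : ZMod 2,
        cosetWEF m i (evPart p + odPart p) (b + b') * cosetWEF m i (odPart p) b' := by
  classical
  simp only [cosetWEF_eq_sum, Finset.sum_mul_sum, ← Fintype.sum_prod_type']
  rw [Fintype.sum_prod_type, Finset.sum_comm, ← (polarSplit m).sum_comp]
  refine Finset.sum_congr rfl fun u _ => ?_
  rw [Finset.sum_eq_single ((polarSplit m u).2 ⟨i, hi⟩)]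
  · rw [ite_zero_mul_ite_zero, ← pow_add, ← hammingNorm_vecMul_Gmat_succ]
    exact if_congr (startsWith_polarSplit_iff m i hi p b u) rfl rfl
  · intro b' _ hb'
    rw [if_neg (c := StartsWith i (odPart p) b' _) fun h => hb' ((h ⟨i, hi⟩).2 rfl).symm,
      mul_zero]
  · simp
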